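/- 27√3/(2^{5/3}·π) = ∑_{n=0}^∞ (−1/27)^n · [(1/3)_n (2/3)_n (5/6)_n / ((1)_n³)] · (5 + 42n). -/

import Mathlib

open Real

/-- Pochhammer symbol (x)_n = x (x+1) ⋯ (x+n-1). -/
noncomputable def poch (x : ℝ) (n : ℕ) : ℝ :=
  ∏ k ∈ Finset.range n, (x + k)

lemma poch_zero (x : ℝ) : poch x 0 = 1 := by simp [poch]

lemma poch_succ (x : ℝ) (n : ℕ) : poch x (n + 1) = poch x n * (x + n) := by
  simp [poch, Finset.prod_range_succ]

lemma poch_pos (x : ℝ) (hx : 0 < x) (n : ℕ) : 0 < poch x n :=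
  Finset.prod_pos fun k _ => by positivity

lemma poch_one (n : ℕ) : poch 1 n = (n.factorial : ℝ) := by
  induction n with
  | zero => simp [poch_zero]
  | succ n ih => rw [poch_succ, ih, Nat.factorial_succ]; push_cast; ring

/-- The basic hypergeometric term. -/
noncomputable def wt (n K : ℕ) : ℝ :=
  (-1) ^ n * (poch (2/3) (n + K) * poch (1/3) (n + 2 * K) * poch (1/3) n * poch (2/3) n *
    poch (5/6) n) / ((n + K).factorial * n.factorial * (3 * n + 2 * K + 2).factorial)

noncomputable def PP (n K : ℝ) : ℝ :=
  (5 + 42 * (n + K)) * (3 * (n + K) + 1) * (3 * (n + K) + 2)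
    - 3 * (126 * (n + K) ^ 2 + 93 * (n + K) + 14) * K + 36 * (3 * (n + K) + 1) * K ^ 2

noncomputable def QQ (n K : ℝ) : ℝ :=
  PP n K - (6 * (n + K) + 5) * (3 * (n + K) + 2) * (3 * n + 6 * K + 1)

lemma wt_succ_right (n K : ℕ) : wt n (K + 1) = wt n K *
    ((2/3 + n + K) * (1/3 + n + 2 * K) * (4/3 + n + 2 * K) /
      ((n + K + 1) * (3 * n + 2 * K + 3) * (3 * n + 2 * K + 4))) := by
  have e1 : n + (K + 1) = (n + K) + 1 := by ring
  have e2 : n + 2 * (K + 1) = (n + 2 * K) + 1 + 1 := by ring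
  have e3 : 3 * n + 2 * (K + 1) + 2 = (3 * n + 2 * K + 2) + 1 + 1 := by ring
  have h1 : ((n + K).factorial : ℝ) ≠ 0 := by positivity
  have h2 : ((n).factorial : ℝ) ≠ 0 := by positivity
  have h3 : ((3 * n + 2 * K + 2).factorial : ℝ) ≠ 0 := by positivity
  have h4 : (n + K + 1 : ℝ) ≠ 0 := by positivity
  have h5 : (3 * n + 2 * K + 3 : ℝ) ≠ 0 := by positivity
  have h6 : (3 * n + 2 * K + 4 : ℝ) ≠ 0 := by positivity
  unfold wt
  rw [e1, e2, e3]
  simp only [poch_succ, Nat.factorial_succ]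
  push_cast
  have h7 : (3 * n + 2 * K + 2 + 1 : ℝ) ≠ 0 := by positivity
  have h8 : (3 * n + 2 * K + 2 + 1 + 1 : ℝ) ≠ 0 := by positivity
  rw [div_mul_div_comm, div_eq_div_iff (by positivity) (by positivity)]
  ring

lemma wt_succ_left (n K : ℕ) : wt (n + 1) K = wt n K *
    (-((2/3 + n + K) * (1/3 + n + 2 * K) * (1/3 + n) * (2/3 + n) * (5/6 + n)) /
      ((n + K + 1) * (n + 1) * (3 * n + 2 * K + 3) * (3 * n + 2 * K + 4)
        * (3 * n + 2 * K + 5))) := by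
  have e1 : (n + 1) + K = (n + K) + 1 := by ring
  have e2 : (n + 1) + 2 * K = (n + 2 * K) + 1 := by ring
  have e3 : 3 * (n + 1) + 2 * K + 2 = (3 * n + 2 * K + 2) + 1 + 1 + 1 := by ring
  unfold wt
  rw [e1, e2, e3]
  simp only [poch_succ, Nat.factorial_succ]
  push_cast
  rw [div_mul_div_comm, div_eq_div_iff (by positivity) (by positivity)]
  ring

lemma wz (n K : ℕ) : wt n (K + 1) * PP n (K + 1 : ℕ) - wt n K * PP n K =
    wt (n + 1) K * QQ (n + 1 : ℕ) K - wt n K * QQ n K := by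
  rw [wt_succ_right, wt_succ_left]
  have h4 : (n + K + 1 : ℝ) ≠ 0 := by positivity
  have h5 : (3 * n + 2 * K + 3 : ℝ) ≠ 0 := by positivity
  have h6 : (3 * n + 2 * K + 4 : ℝ) ≠ 0 := by positivity
  have h7 : (3 * n + 2 * K + 5 : ℝ) ≠ 0 := by positivity
  have h8 : (n + 1 : ℝ) ≠ 0 := by positivity
  unfold QQ PP
  push_cast
  field_simp
  ring

lemma QQ_zero (K : ℝ) : QQ 0 K = 0 := by
  unfold QQ PP; ring

lemma poch_le (x : ℝ) (hx : 0 < x) (hx1 : x ≤ 1) (n : ℕ) : poch x n ≤ n.factorial := by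
  rw [← poch_one]
  exact Finset.prod_le_prod (fun k _ => by positivity) (fun k _ => by linarith)

lemma wt_zero_bound (K : ℕ) : |wt 0 K| ≤ 1 / ((2 * K + 1) * (2 * K + 2)) := by
  have h1 := poch_le (2/3) (by norm_num) (by norm_num) K
  have h2 := poch_le (1/3) (by norm_num) (by norm_num) (2 * K)
  have p1 := poch_pos (2/3) (by norm_num) K
  have p2 := poch_pos (1/3) (by norm_num) (2 * K)
  have hh : wt 0 K = poch (2/3) K * poch (1/3) (2 * K) /
      (K.factorial * ((2 * K + 2) * ((2 * K + 1) * (2 * K).factorial))) := by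
    unfold wt
    simp only [poch_zero, Nat.factorial_succ, Nat.mul_zero, Nat.zero_add, Nat.factorial_zero]
    push_cast
    ring
  rw [hh, abs_of_nonneg (by positivity), div_le_div_iff₀ (by positivity) (by positivity)]
  have h3 : poch (2/3) K * poch (1/3) (2 * K) ≤ K.factorial * (2 * K).factorial := by gcongr
  have := mul_le_mul_of_nonneg_right h3 (by positivity : (0:ℝ) ≤ (2 * K + 1) * (2 * K + 2))
  nlinarith [this]

lemma wt_step (n K : ℕ) : |wt (n + 1) K| ≤ |wt n K| * (1 / 9) := by
  rw [wt_succ_left, abs_mul]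
  gcongr
  rw [abs_div, abs_neg, abs_of_nonneg (by positivity), abs_of_nonneg (by positivity),
    div_le_div_iff₀ (by positivity) (by positivity), one_mul]
  have a1 : (2/3 + n + K : ℝ) ≤ n + K + 1 := by linarith
  have a2 : (1/3 + n + 2 * K : ℝ) ≤ 3 * n + 2 * K + 5 := by
    have : (0:ℝ) ≤ n := by positivity
    linarith
  have a3 : (1/3 + n : ℝ) * 3 ≤ (3 * n + 2 * K + 3) := by
    have : (0:ℝ) ≤ K := by positivity
    linarith
  have a4 : (5/6 + n : ℝ) * 3 ≤ (3 * n + 2 * K + 4) := by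
    have : (0:ℝ) ≤ K := by positivity
    linarith
  have a5 : (2/3 + n : ℝ) ≤ n + 1 := by linarith
  calc (2/3 + n + K : ℝ) * (1/3 + n + 2 * K) * (1/3 + n) * (2/3 + n) * (5/6 + n) * 9
      = (2/3 + n + K) * (2/3 + n) * ((1/3 + n) * 3) * ((5/6 + n) * 3) * (1/3 + n + 2 * K) := by
        ring
    _ ≤ _ := by gcongr

lemma wt_one_bound (K : ℕ) : |wt 1 K| ≤ 1 / ((K:ℝ) + 1) ^ 4 := by
  have h0 := wt_zero_bound K
  have h := wt_succ_left 0 K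
  rw [Nat.zero_add] at h
  rw [h, abs_mul]
  have hb : |(-((2/3 + (0:ℕ) + K) * (1/3 + (0:ℕ) + 2 * K) * (1/3 + (0:ℕ)) * (2/3 + (0:ℕ)) * (5/6 + (0:ℕ))) /
      (((0:ℕ) + K + 1) * ((0:ℕ) + 1) * (3 * (0:ℕ) + 2 * K + 3) * (3 * (0:ℕ) + 2 * K + 4)
        * (3 * (0:ℕ) + 2 * K + 5)) : ℝ)| ≤ 1 / ((K:ℝ) + 1) ^ 2 := by
    rw [abs_div, abs_neg, abs_of_nonneg (by positivity), abs_of_nonneg (by positivity),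
      div_le_div_iff₀ (by positivity) (by positivity), one_mul]
    have : (0:ℝ) ≤ K := by positivity
    push_cast
    generalize (K : ℝ) = y at this ⊢
    rw [← sub_nonneg]
    ring_nf
    positivity
  have h0' : |wt 0 K| ≤ 1 / ((K:ℝ) + 1) ^ 2 := by
    refine h0.trans ?_
    have : (0:ℝ) ≤ K := by positivity
    apply one_div_le_one_div_of_le (by positivity)
    nlinarith
  calc _ ≤ (1 / ((K:ℝ) + 1) ^ 2) * (1 / ((K:ℝ) + 1) ^ 2) := by gcongr
    _ = _ := by field_simp

lemma wt_bound (n K : ℕ) : |wt (n + 1) K| ≤ (1 / 9) ^ n / ((K:ℝ) + 1) ^ 4 := by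
  induction n with
  | zero => simpa using wt_one_bound K
  | succ n ih =>
    calc _ ≤ _ := wt_step (n + 1) K
      _ ≤ (1 / 9) ^ n / ((K:ℝ) + 1) ^ 4 * (1 / 9) := by gcongr
      _ = _ := by ring

lemma PP_bound (n K : ℕ) : |PP (n + 1 : ℕ) K| ≤ 10000 * ((n:ℝ) + 1) ^ 3 * ((K:ℝ) + 1) ^ 3 := by
  unfold PP
  push_cast
  generalize hx : (n : ℝ) = x
  generalize hy : (K : ℝ) = y
  have x0 : 0 ≤ x := hx ▸ Nat.cast_nonneg n
  have y0 : 0 ≤ y := hy ▸ Nat.cast_nonneg K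
  rw [abs_le]
  constructor <;> rw [← sub_nonneg] <;> ring_nf <;> positivity

lemma QQ_bound (n K : ℕ) : |QQ (n + 1 : ℕ) K| ≤ 10000 * ((n:ℝ) + 1) ^ 3 * ((K:ℝ) + 1) ^ 3 := by
  unfold QQ PP
  push_cast
  generalize hx : (n : ℝ) = x
  generalize hy : (K : ℝ) = y
  have x0 : 0 ≤ x := hx ▸ Nat.cast_nonneg n
  have y0 : 0 ≤ y := hy ▸ Nat.cast_nonneg K
  rw [abs_le]
  constructor <;> rw [← sub_nonneg] <;> ring_nf <;> positivity

noncomputable def bd (n : ℕ) : ℝ := 10000 * (((n:ℝ) + 1) ^ 3 * (1 / 9) ^ n)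

lemma bd_summable : Summable bd := by
  have h := summable_pow_mul_geometric_of_norm_lt_one (R := ℝ) 3 (r := 1/9) (by norm_num)
  have h2 := (summable_nat_add_iff 1).2 h
  have h3 := h2.mul_left (10000 * 9)
  refine h3.congr fun n => ?_
  unfold bd
  push_cast
  ring

lemma prod_bound (n K : ℕ) (R : ℝ) (hR : |R| ≤ 10000 * ((n:ℝ) + 1) ^ 3 * ((K:ℝ) + 1) ^ 3) :
    |wt (n + 1) K * R| ≤ bd n * (1 / ((K:ℝ) + 1)) := by
  rw [abs_mul]
  have := wt_bound n K
  calc _ ≤ ((1 / 9) ^ n / ((K:ℝ) + 1) ^ 4) * (10000 * ((n:ℝ) + 1) ^ 3 * ((K:ℝ) + 1) ^ 3) := by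
        gcongr
    _ = _ := by unfold bd; field_simp

lemma prod_bound' (n K : ℕ) (R : ℝ) (hR : |R| ≤ 10000 * ((n:ℝ) + 1) ^ 3 * ((K:ℝ) + 1) ^ 3) :
    |wt (n + 1) K * R| ≤ bd n := by
  refine (prod_bound n K R hR).trans ?_
  have h : (1 / ((K:ℝ) + 1)) ≤ 1 := by
    rw [div_le_one (by positivity)]
    have : (0:ℝ) ≤ K := by positivity
    linarith
  have hb : 0 ≤ bd n := by unfold bd; positivity
  nlinarith

noncomputable def UU (K n : ℕ) : ℝ := wt n K * PP n K
noncomputable def VV (K n : ℕ) : ℝ := wt n K * QQ n K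

lemma UU_summable_succ (K : ℕ) : Summable fun n => UU K (n + 1) :=
  Summable.of_norm_bounded bd_summable fun n => prod_bound' n K _ (PP_bound n K)

lemma UU_summable (K : ℕ) : Summable (UU K) :=
  (summable_nat_add_iff 1).1 (UU_summable_succ K)

lemma VV_summable (K : ℕ) : Summable (VV K) :=
  (summable_nat_add_iff 1).1 
    (Summable.of_norm_bounded bd_summable fun n => prod_bound' n K _ (QQ_bound n K))

lemma VV_zero (K : ℕ) : VV K 0 = 0 := by
  unfold VV; rw [Nat.cast_zero, QQ_zero, mul_zero]

lemma tsum_step (K : ℕ) : ∑' n, UU (K + 1) n = ∑' n, UU K n := by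
  have hV := VV_summable K
  have hV1 := (summable_nat_add_iff 1).2 hV
  have h : ∀ n, UU (K + 1) n - UU K n = VV K (n + 1) - VV K n := fun n => wz n K
  rw [← sub_eq_zero, ← (UU_summable (K + 1)).tsum_sub (UU_summable K)]
  simp_rw [h]
  rw [hV1.tsum_sub hV, hV.tsum_eq_zero_add, VV_zero]
  ring

lemma UU_tsum_const (K : ℕ) : ∑' n, UU K n = ∑' n, UU 0 n := by
  induction K with
  | zero => rfl
  | succ K ih => rw [tsum_step, ih]

open Filter Topology

lemma tail_tendsto : Tendsto (fun K : ℕ => ∑' n, UU K (n + 1)) atTop (𝓝 0) := by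
  have h := tendsto_tsum_of_dominated_convergence (𝓕 := atTop)
    (f := fun K n => UU K (n + 1)) (g := fun _ : ℕ => (0:ℝ)) bd_summable
    (fun n => by
      refine squeeze_zero_norm (fun K => prod_bound n K _ (PP_bound n K)) ?_
      simpa using (tendsto_one_div_add_atTop_nhds_zero_nat (𝕜 := ℝ)).const_mul (bd n))
    (Eventually.of_forall fun K n => prod_bound' n K _ (PP_bound n K))
  simpa using h

lemma poch_gammaSeq (s : ℝ) (hs : 0 < s) (n : ℕ) (hn : 0 < n) :
    poch s n = (n:ℝ) ^ s * n.factorial / Real.GammaSeq s n / (s + n) := by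
  have h : poch s (n + 1) ≠ 0 := (poch_pos s hs _).ne'
  have hg : Real.GammaSeq s n = (n:ℝ) ^ s * n.factorial / poch s (n + 1) := rfl
  have h2 : (n:ℝ) ^ s ≠ 0 := by positivity
  have h3 : (n.factorial:ℝ) ≠ 0 := by positivity
  rw [hg, poch_succ] at *
  have : s + n ≠ 0 := by positivity
  field_simp

lemma UU_zero_eq (K : ℕ) (hK : 0 < K) : UU K 0 = 2 ^ ((1:ℝ)/3) /
    (Real.GammaSeq (2/3) K * Real.GammaSeq (1/3) (2 * K)) *
    (9 * (K:ℝ) * (6 * K + 5) / ((2 * K + 1) * (2 * K + 2))) := by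
  have hh : wt 0 K = poch (2/3) K * poch (1/3) (2 * K) /
      (K.factorial * ((2 * K + 2) * ((2 * K + 1) * (2 * K).factorial))) := by
    unfold wt
    simp only [poch_zero, Nat.factorial_succ, Nat.mul_zero, Nat.zero_add, Nat.factorial_zero]
    push_cast
    ring
  have hP : PP (0:ℕ) K = (6 * K + 5) * (3 * K + 2) * (6 * K + 1) := by
    unfold PP; push_cast; ring
  have hK' : (0:ℝ) < K := by exact_mod_cast hK
  have g1 : Real.GammaSeq (2/3) K ≠ 0 := by
    have hg : Real.GammaSeq (2/3) K = (K:ℝ) ^ ((2:ℝ)/3) * K.factorial / poch (2/3) (K + 1) := rfl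
    have := poch_pos (2/3) (by norm_num) (K + 1)
    rw [hg]; positivity
  have g2 : Real.GammaSeq (1/3) (2 * K) ≠ 0 := by
    have hg : Real.GammaSeq (1/3) (2 * K) =
      ((2 * K : ℕ):ℝ) ^ ((1:ℝ)/3) * (2 * K).factorial / poch (1/3) (2 * K + 1) := rfl
    have := poch_pos (1/3) (by norm_num) (2 * K + 1)
    rw [hg]; positivity
  have hr : (K:ℝ) ^ ((2:ℝ)/3) * ((2 * K : ℕ):ℝ) ^ ((1:ℝ)/3) = 2 ^ ((1:ℝ)/3) * K := by
    push_cast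
    rw [Real.mul_rpow (by norm_num) hK'.le]
    have : (K:ℝ) ^ ((2:ℝ)/3) * (K:ℝ) ^ ((1:ℝ)/3) = K := by
      rw [← Real.rpow_add hK']; norm_num
    linear_combination (2:ℝ) ^ ((1:ℝ)/3) * this
  unfold UU
  rw [hh, hP, poch_gammaSeq (2/3) (by norm_num) K hK,
    poch_gammaSeq (1/3) (by norm_num) (2 * K) (by omega)]
  have f1 : (K.factorial : ℝ) ≠ 0 := by positivity
  have f2 : ((2 * K).factorial : ℝ) ≠ 0 := by positivity
  have e : ∀ a b c d x y : ℝ, a * c / x / (2/3 + K) * (b * d / y / (1/3 + ((2 * K : ℕ):ℝ))) =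
      9 * ((a * b) * c * d / (x * y)) / ((3 * K + 2) * (6 * K + 1)) := by
    intro a b c d x y
    have q1 : (2/3 + K : ℝ) = (3 * K + 2) / 3 := by ring
    have q2 : (1/3 + ((2 * K : ℕ):ℝ)) = (6 * K + 1) / 3 := by push_cast; ring
    rw [q1, q2]
    field_simp
    ring
  rw [e, hr]
  field_simp

lemma gamma_prod : Real.Gamma (2/3) * Real.Gamma (1/3) = 2 * π / Real.sqrt 3 := by
  have h := Real.Gamma_mul_Gamma_one_sub (1/3)
  rw [show (1:ℝ) - 1/3 = 2/3 by norm_num, show π * (1/3) = π / 3 by ring, Real.sin_pi_div_three] at h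
  rw [mul_comm, h]
  field_simp

lemma head_tendsto : Tendsto (fun K : ℕ => UU K 0) atTop
    (𝓝 (27 * Real.sqrt 3 / ((2 : ℝ) ^ ((5 : ℝ) / 3) * π))) := by
  have h1 := Real.GammaSeq_tendsto_Gamma (2/3)
  have h2 := (Real.GammaSeq_tendsto_Gamma (1/3)).comp
    (tendsto_id.const_mul_atTop' (show 0 < 2 by norm_num) : Tendsto (fun K : ℕ => 2 * K) atTop atTop)
  have h3 : Tendsto (fun K : ℕ => 1 / (K:ℝ)) atTop (𝓝 0) := tendsto_one_div_atTop_nhds_zero_nat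
  have hG : Real.Gamma (2/3) * Real.Gamma (1/3) ≠ 0 := by
    rw [gamma_prod]; positivity
  have h4 : Tendsto (fun K : ℕ => 9 * (6 + 5 * (1 / (K:ℝ))) /
      ((2 + 1 / (K:ℝ)) * (2 + 2 * (1 / (K:ℝ))))) atTop
      (𝓝 (9 * (6 + 5 * 0) / ((2 + 0) * (2 + 2 * 0)))) :=
    (((h3.const_mul 5).const_add 6).const_mul 9).div
      ((h3.const_add 2).mul ((h3.const_mul 2).const_add 2)) (by norm_num)
  have h5 := ((tendsto_const_nhds (x := (2:ℝ) ^ ((1:ℝ)/3))).div (h1.mul h2) hG).mul h4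
  have hv : 27 * Real.sqrt 3 / ((2 : ℝ) ^ ((5 : ℝ) / 3) * π) =
      (2:ℝ) ^ ((1:ℝ)/3) / (Real.Gamma (2/3) * Real.Gamma (1/3)) *
      (9 * (6 + 5 * 0) / ((2 + 0) * (2 + 2 * 0))) := by
    rw [gamma_prod]
    have hr : (2:ℝ) ^ ((1:ℝ)/3) * (2:ℝ) ^ ((5:ℝ)/3) = 4 := by
      rw [← Real.rpow_add (by norm_num)]; norm_num
    have h2p : (2:ℝ) ^ ((5:ℝ)/3) ≠ 0 := by positivity
    have h2q : (2:ℝ) ^ ((1:ℝ)/3) = 4 / (2:ℝ) ^ ((5:ℝ)/3) := by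
      rw [eq_div_iff h2p, hr]
    rw [h2q]
    have hpi := Real.pi_ne_zero
    have h33 : Real.sqrt 3 ≠ 0 := by positivity
    field_simp
    norm_num
  rw [hv]
  refine h5.congr' ?_
  filter_upwards [eventually_gt_atTop 0] with K hK
  rw [UU_zero_eq K hK]
  have hK' : (0:ℝ) < K := by exact_mod_cast hK
  have : 9 * (6 + 5 * (1 / (K:ℝ))) / ((2 + 1 / (K:ℝ)) * (2 + 2 * (1 / (K:ℝ)))) =
      9 * (K:ℝ) * (6 * K + 5) / ((2 * K + 1) * (2 * K + 2)) := by
    field_simp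
  rw [this]
  rfl

lemma fact3 (n : ℕ) : ((3 * n + 2).factorial : ℝ) =
    27 ^ n * n.factorial * poch (1/3) n * poch (2/3) n * (3 * n + 1) * (3 * n + 2) := by
  induction n with
  | zero => simp [poch_zero]
  | succ n ih =>
    rw [show 3 * (n + 1) + 2 = (3 * n + 2) + 1 + 1 + 1 by ring]
    simp only [Nat.factorial_succ, poch_succ] at ih ⊢
    push_cast at ih ⊢
    rw [ih]
    ring

lemma UU_at_zero (n : ℕ) : UU 0 n = (-1/27 : ℝ) ^ n *
      (poch (1/3) n * poch (2/3) n * poch (5/6) n / poch 1 n ^ 3) *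
      (5 + 42 * n) := by
  have hP : PP n (0:ℕ) = (5 + 42 * n) * (3 * n + 1) * (3 * n + 2) := by
    unfold PP; push_cast; ring
  have p1 := (poch_pos (1/3) (by norm_num) n).ne'
  have p2 := (poch_pos (2/3) (by norm_num) n).ne'
  have p3 : (n.factorial : ℝ) ≠ 0 := by positivity
  have p4 : (3 * n + 1 : ℝ) ≠ 0 := by positivity
  have p5 : (3 * n + 2 : ℝ) ≠ 0 := by positivity
  unfold UU
  rw [hP]
  unfold wt
  simp only [Nat.mul_zero, Nat.add_zero]
  rw [fact3, poch_one, div_pow]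
  field_simp

theorem series_27sqrt3 :
    27 * Real.sqrt 3 / ((2 : ℝ) ^ ((5 : ℝ) / 3) * π) = ∑' n : ℕ, (-1/27 : ℝ) ^ n *
      (poch (1/3) n * poch (2/3) n * poch (5/6) n / poch 1 n ^ 3) *
      (5 + 42 * n) := by
  have hs : ∀ K, UU K 0 + ∑' n, UU K (n + 1) = ∑' n, UU 0 n := fun K => by
    rw [← (UU_summable K).tsum_eq_zero_add, UU_tsum_const]
  have h := head_tendsto.add tail_tendsto
  simp only [hs, add_zero] at h
  have h' := tendsto_nhds_unique h tendsto_const_nhds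
  rw [h']
  exact tsum_congr UU_at_zero
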